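/- Let T ∈ ℕ, let a ≥ 0 and r₀ ∈ (0,1] be real numbers, and let N : ℕ → ℝ with N i ≥ 0 for all i. Suppose Δ : Fin T → ℝ and ρ : Fin T → ℝ are such that: (1) for every t there exists i ∈ ℕ with ρ t = 2^(−i); (2) 0 ≤ Δ t ≤ 14 * ρ t for every t; and (3) for every i ∈ ℕ with 2^(−i) ≥ r₀, the number of indices t with ρ t = 2^(−i) is at most N i * (2 + 2 * 2^(2i) * (1 + 2a)). Then ∑_t Δ t ≤ 28*T*r₀ + ∑_{i ∈ ℕ, r₀ ≤ 2^(−i) ≤ 1} 56 * 2^i * N i * (1 + a). -/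

import Mathlib

/-- Lemma 5 of the paper (combinatorial content). -/
theorem stmt_1 (T : ℕ) (a r₀ : ℝ) (ha : 0 ≤ a) (hr₀ : r₀ ∈ Set.Ioc (0:ℝ) 1)
    (N : ℕ → ℝ) (hN : ∀ i, 0 ≤ N i)
    (Δ ρ : Fin T → ℝ)
    (h1 : ∀ t, ∃ i : ℕ, ρ t = ((2:ℝ) ^ i)⁻¹)
    (h2 : ∀ t, 0 ≤ Δ t ∧ Δ t ≤ 14 * ρ t)
    (h3 : ∀ i : ℕ, r₀ ≤ ((2:ℝ) ^ i)⁻¹ →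
      ((Finset.univ.filter (fun t : Fin T => ρ t = ((2:ℝ) ^ i)⁻¹)).card : ℝ)
        ≤ N i * (2 + 2 * (2:ℝ) ^ (2 * i) * (1 + 2 * a))) :
    ∑ t : Fin T, Δ t ≤ 28 * T * r₀ + ∑' i : ℕ,
      (if r₀ ≤ ((2:ℝ) ^ i)⁻¹ ∧ ((2:ℝ) ^ i)⁻¹ ≤ 1
        then 56 * (2:ℝ) ^ i * N i * (1 + a) else 0) := by
  obtain ⟨hr, hr1⟩ := hr₀
  obtain ⟨K, hK⟩ : ∃ K : ℕ, ((2:ℝ) ^ K)⁻¹ < r₀ := by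
    obtain ⟨K, hK⟩ := exists_pow_lt_of_lt_one hr (show (1/2:ℝ) < 1 by norm_num)
    exact ⟨K, by simpa using hK⟩
  have hlt : ∀ i : ℕ, r₀ ≤ ((2:ℝ) ^ i)⁻¹ → i < K := by
    intro i hi
    by_contra hc
    have h : (2:ℝ) ^ K ≤ 2 ^ i := pow_le_pow_right₀ (by norm_num) (not_lt.mp hc)
    have h' : ((2:ℝ) ^ i)⁻¹ ≤ ((2:ℝ) ^ K)⁻¹ := inv_anti₀ (by positivity) h
    linarith
  rw [tsum_eq_sum (s := Finset.range K) (by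
    intro i hi
    rw [if_neg]
    rintro ⟨h, -⟩
    exact hi (Finset.mem_range.mpr (hlt i h)))]
  have hpt : ∀ t : Fin T, Δ t ≤ 28 * r₀ + ∑ i ∈ Finset.range K,
      (if r₀ ≤ ((2:ℝ) ^ i)⁻¹ then
        (if ρ t = ((2:ℝ) ^ i)⁻¹ then 14 * ((2:ℝ) ^ i)⁻¹ else 0) else 0) := by
    intro t
    have hnn : ∀ i ∈ Finset.range K, (0:ℝ) ≤ (if r₀ ≤ ((2:ℝ) ^ i)⁻¹ then
        (if ρ t = ((2:ℝ) ^ i)⁻¹ then 14 * ((2:ℝ) ^ i)⁻¹ else 0) else 0) := by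
      intro i _
      split_ifs <;> positivity
    obtain ⟨j, hj⟩ := h1 t
    have h2t := (h2 t).2
    by_cases hc : r₀ ≤ ((2:ℝ) ^ j)⁻¹
    · have h := Finset.single_le_sum hnn (Finset.mem_range.mpr (hlt j hc))
      rw [if_pos hc, if_pos hj] at h
      rw [hj] at h2t
      linarith
    · have h := Finset.sum_nonneg hnn
      rw [not_le, ← hj] at hc
      linarith
  refine (Finset.sum_le_sum (fun t _ => hpt t)).trans ?_
  rw [Finset.sum_add_distrib, Finset.sum_comm]
  refine add_le_add (le_of_eq ?_) (Finset.sum_le_sum ?_)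
  · simp
    ring
  · intro i _
    by_cases hc : r₀ ≤ ((2:ℝ) ^ i)⁻¹
    · have hp : (1:ℝ) ≤ 2 ^ i := one_le_pow₀ (by norm_num)
      have hi : ((2:ℝ) ^ i)⁻¹ ≤ 1 := inv_le_one_of_one_le₀ hp
      simp only [hc, hi, and_self, if_true]
      rw [← Finset.sum_filter, Finset.sum_const, nsmul_eq_mul]
      have h := h3 i hc
      have hq : (0:ℝ) ≤ 14 * ((2:ℝ) ^ i)⁻¹ := by positivity
      refine (mul_le_mul_of_nonneg_right h hq).trans ?_
      have e : N i * (2 + 2 * (2:ℝ) ^ (2 * i) * (1 + 2 * a)) * (14 * ((2:ℝ) ^ i)⁻¹)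
          = 28 * N i * (((2:ℝ) ^ i)⁻¹ + 2 ^ i * (1 + 2 * a)) := by
        rw [two_mul i, pow_add]
        field_simp
        ring
      rw [e]
      have : 28 * N i * (((2:ℝ) ^ i)⁻¹ + 2 ^ i * (1 + 2 * a))
          ≤ 28 * N i * ((2:ℝ) ^ i + 2 ^ i * (1 + 2 * a)) :=
        mul_le_mul_of_nonneg_left (by linarith) (by linarith [hN i])
      refine this.trans (le_of_eq (by ring))
    · simp [hc]
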